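/- Let N, q, h, T be positive integers, p ∈ [0, 1/2], X ∈ ℝ^{N×q}, and let σ : ℝ → ℝ be 1-Lipschitz with σ(0) = 0. Fix nonnegative reals B^{(0)}, …, B^{(T-1)}. For weight matrices W^{(0)} ∈ ℝ^{q×h} and W^{(1)}, …, W^{(T-1)} ∈ ℝ^{h×h} such that every column of W^{(l)} has ℓ1-norm at most B^{(l)} for l = 0, …, T−1, set X_T = σ(σ(⋯σ(X W^{(0)}) W^{(1)} ⋯) W^{(T-1)}) ∈ ℝ^{N×h} (σ applied entrywise, T layers). Let ε be a transductive Rademacher vector with parameter p. Then E_ε[ sup over all admissible weight tuples, sup over columns c ∈ {1,…,h}, of |Σ_{n=1}^N ε_n (X_T)_{nc}| ] ≤ 2^T (∏_{l=0}^{T-1} B^{(l)}) √(2p) ‖X‖_F. -/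

import Mathlib

open Finset

/-- Expectation with respect to a transductive Rademacher vector
`ε ∈ ℝ^N` with i.i.d. coordinates: `P(ε_i = 1) = P(ε_i = -1) = p`,
`P(ε_i = 0) = 1 - 2p`. -/
noncomputable def tExp (N : ℕ) (p : ℝ) (f : (Fin N → ℝ) → ℝ) : ℝ :=
  ∑ s : Fin N → Fin 3,
    (∏ i, (![p, p, 1 - 2 * p] : Fin 3 → ℝ) (s i)) *
      f (fun i => (![(1 : ℝ), -1, 0]) (s i))

/-- Frobenius norm of a real matrix. -/
noncomputable def frob {m n : ℕ} (X : Matrix (Fin m) (Fin n) ℝ) : ℝ :=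
  Real.sqrt (∑ i, ∑ j, (X i j) ^ 2)

/-- `mlp σ X W0 Ws t` is the output of a `(t+1)`-layer MLP with entrywise
activation `σ`: layer `0` is `σ(X W0)`, layer `k+1` multiplies by `Ws k`. -/
noncomputable def mlp {N q h : ℕ} (σ : ℝ → ℝ) (X : Matrix (Fin N) (Fin q) ℝ)
    (W0 : Matrix (Fin q) (Fin h) ℝ) (Ws : ℕ → Matrix (Fin h) (Fin h) ℝ) :
    ℕ → Matrix (Fin N) (Fin h) ℝ
  | 0 => Matrix.of fun i j => σ ((X * W0) i j)
  | (k + 1) => Matrix.of fun i j => σ ((mlp σ X W0 Ws k * Ws k) i j)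

theorem prod_weights_nonneg {N : ℕ} {p : ℝ} (hp0 : 0 ≤ p) (hp : p ≤ 1 / 2)
    (s : Fin N → Fin 3) : 0 ≤ ∏ i, (![p, p, 1 - 2 * p] : Fin 3 → ℝ) (s i) := by
  refine Finset.prod_nonneg fun i _ => ?_
  generalize s i = k
  fin_cases k <;> simp <;> linarith

theorem tExp_mono {N : ℕ} {p : ℝ} (hp0 : 0 ≤ p) (hp : p ≤ 1 / 2) {f g : (Fin N → ℝ) → ℝ}
    (h : ∀ ε, f ε ≤ g ε) : tExp N p f ≤ tExp N p g := by
  refine Finset.sum_le_sum fun s _ => mul_le_mul_of_nonneg_left (h _) (prod_weights_nonneg hp0 hp s)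

theorem tExp_add {N : ℕ} {p : ℝ} (f g : (Fin N → ℝ) → ℝ) :
    tExp N p (fun ε => f ε + g ε) = tExp N p f + tExp N p g := by
  simp only [tExp, mul_add, Finset.sum_add_distrib]

theorem tExp_const_mul {N : ℕ} {p : ℝ} (a : ℝ) (f : (Fin N → ℝ) → ℝ) :
    tExp N p (fun ε => a * f ε) = a * tExp N p f := by
  simp only [tExp, Finset.mul_sum]
  exact Finset.sum_congr rfl fun s _ => by ring

theorem tExp_sum {N : ℕ} {p : ℝ} {κ : Type*} (S : Finset κ) (f : κ → (Fin N → ℝ) → ℝ) :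
    tExp N p (fun ε => ∑ k ∈ S, f k ε) = ∑ k ∈ S, tExp N p (f k) := by
  simp only [tExp, Finset.mul_sum]
  exact Finset.sum_comm

theorem sum_prod_weights {N : ℕ} (p : ℝ) :
    ∑ s : Fin N → Fin 3, ∏ i, (![p, p, 1 - 2 * p] : Fin 3 → ℝ) (s i) = 1 := by
  rw [← Fintype.prod_sum fun (_ : Fin N) k => (![p, p, 1 - 2 * p] : Fin 3 → ℝ) k]
  refine Finset.prod_eq_one fun i _ => ?_
  simp [Fin.sum_univ_three]
  ring

/-- The law of a transductive Rademacher vector is invariant under flipping the signs of the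
coordinates in `A`. -/
theorem tExp_flip {N : ℕ} {p : ℝ} (A : Finset (Fin N)) (f : (Fin N → ℝ) → ℝ) :
    tExp N p (fun ε => f fun i => if i ∈ A then -ε i else ε i) = tExp N p f := by
  unfold tExp
  let e : (Fin N → Fin 3) ≃ (Fin N → Fin 3) :=
    Equiv.piCongrRight fun i => if i ∈ A then Equiv.swap 0 1 else Equiv.refl _
  refine Fintype.sum_equiv e _ _ fun s => ?_
  have hw : ∀ i, (![p, p, 1 - 2 * p] : Fin 3 → ℝ) (e s i)
      = (![p, p, 1 - 2 * p] : Fin 3 → ℝ) (s i) := by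
    intro i
    simp only [e, Equiv.piCongrRight_apply, Pi.map_apply]
    generalize s i = k
    split_ifs
    · fin_cases k
      · simp
      · simp
      · rw [Equiv.swap_apply_of_ne_of_ne] <;> decide
    · rfl
  have hv : (fun i => (![(1 : ℝ), -1, 0]) (e s i))
      = fun i => if i ∈ A then -(![(1 : ℝ), -1, 0]) (s i) else (![(1 : ℝ), -1, 0]) (s i) := by
    funext i
    simp only [e, Equiv.piCongrRight_apply, Pi.map_apply]
    generalize s i = k
    split_ifs
    · fin_cases k
      · simp
      · simp
      · rw [Equiv.swap_apply_of_ne_of_ne]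
        · simp
        · decide
        · decide
    · rfl
  simp only [hw, hv]

theorem tExp_sq {N : ℕ} {p : ℝ} (n : Fin N) : tExp N p (fun ε => ε n * ε n) = 2 * p := by
  unfold tExp
  have key : ∀ s : Fin N → Fin 3,
      (∏ i, (![p, p, 1 - 2 * p] : Fin 3 → ℝ) (s i)) *
        ((![(1 : ℝ), -1, 0]) (s n) * (![(1 : ℝ), -1, 0]) (s n))
      = ∏ i, (if i = n then ![p, p, 0] (s i) else (![p, p, 1 - 2 * p] : Fin 3 → ℝ) (s i)) := by
    intro s
    rw [← Finset.mul_prod_erase _ _ (Finset.mem_univ n),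
      ← Finset.mul_prod_erase univ (fun i => if i = n then _ else _) (Finset.mem_univ n)]
    have h1 : ∏ i ∈ univ.erase n,
        (if i = n then ![p, p, 0] (s i) else (![p, p, 1 - 2 * p] : Fin 3 → ℝ) (s i))
        = ∏ i ∈ univ.erase n, (![p, p, 1 - 2 * p] : Fin 3 → ℝ) (s i) :=
      Finset.prod_congr rfl fun i hi => if_neg (Finset.ne_of_mem_erase hi)
    rw [h1, if_pos rfl]
    generalize s n = k
    fin_cases k <;> simp
  simp only [key]
  rw [← Fintype.prod_sum fun (i : Fin N) k =>
    if i = n then ![p, p, 0] k else (![p, p, 1 - 2 * p] : Fin 3 → ℝ) k]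
  rw [Finset.prod_eq_single n]
  · simp [Fin.sum_univ_three]
    ring
  · intro i _ hi
    simp [Fin.sum_univ_three, hi]
    ring
  · simp

theorem tExp_mul_of_ne {N : ℕ} {p : ℝ} {n m : Fin N} (h : n ≠ m) :
    tExp N p (fun ε => ε n * ε m) = 0 := by
  have h1 := tExp_flip (p := p) {n} (fun ε => ε n * ε m)
  have h2 : (fun ε : Fin N → ℝ => (if n ∈ ({n} : Finset (Fin N)) then -ε n else ε n) *
      (if m ∈ ({n} : Finset (Fin N)) then -ε m else ε m)) = fun ε => (-1) * (ε n * ε m) := by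
    funext ε
    simp [h.symm]
  rw [h2, tExp_const_mul] at h1
  linarith

theorem tExp_dot_sq {N : ℕ} {p : ℝ} (x : Fin N → ℝ) :
    tExp N p (fun ε => (∑ n, ε n * x n) ^ 2) = 2 * p * ∑ n, x n ^ 2 := by
  have h : (fun ε : Fin N → ℝ => (∑ n, ε n * x n) ^ 2)
      = fun ε => ∑ n, ∑ m, (x n * x m) * (ε n * ε m) := by
    funext ε
    rw [sq, Finset.sum_mul_sum]
    exact Finset.sum_congr rfl fun n _ => Finset.sum_congr rfl fun m _ => by ring
  rw [h, tExp_sum, Finset.mul_sum]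
  refine Finset.sum_congr rfl fun n _ => ?_
  rw [tExp_sum, Finset.sum_eq_single n]
  · rw [tExp_const_mul, tExp_sq]
    ring
  · intro m _ hm
    rw [tExp_const_mul, tExp_mul_of_ne hm.symm, mul_zero]
  · simp

/-- Jensen's inequality for the square root. -/
theorem tExp_sqrt_le {N : ℕ} {p : ℝ} (hp0 : 0 ≤ p) (hp : p ≤ 1 / 2) {f : (Fin N → ℝ) → ℝ}
    (hf : ∀ ε, 0 ≤ f ε) : tExp N p (fun ε => √(f ε)) ≤ √(tExp N p f) := by
  exact Real.strictConcaveOn_sqrt.concaveOn.le_map_sum (t := univ)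
    (fun s _ => prod_weights_nonneg hp0 hp s) (sum_prod_weights p) fun s _ => hf _

/-- A family of vectors that is uniformly bounded in every coordinate. -/
def UniformlyBounded {N : ℕ} {ι : Type*} (f : ι → Fin N → ℝ) : Prop :=
  ∃ C, ∀ i n, |f i n| ≤ C

theorem UniformlyBounded.exists_abs_dot_le {N : ℕ} {ι : Type*} {f : ι → Fin N → ℝ}
    (hf : UniformlyBounded f) (ε : Fin N → ℝ) : ∃ C, ∀ i, |∑ n, ε n * f i n| ≤ C := by
  obtain ⟨C, hC⟩ := hf
  refine ⟨∑ n, |ε n| * C, fun i => (Finset.abs_sum_le_sum_abs _ _).trans ?_⟩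
  refine Finset.sum_le_sum fun n _ => ?_
  rw [abs_mul]
  exact mul_le_mul_of_nonneg_left (hC i n) (abs_nonneg _)

theorem UniformlyBounded.bddAbove_dot {N : ℕ} {ι : Type*} {f : ι → Fin N → ℝ}
    (hf : UniformlyBounded f) (ε : Fin N → ℝ) :
    BddAbove (Set.range fun i => ∑ n, ε n * f i n) := by
  obtain ⟨C, hC⟩ := hf.exists_abs_dot_le ε
  exact ⟨C, by rintro _ ⟨i, rfl⟩; exact (le_abs_self _).trans (hC i)⟩

theorem UniformlyBounded.bddAbove_abs_dot {N : ℕ} {ι : Type*} {f : ι → Fin N → ℝ}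
    (hf : UniformlyBounded f) (ε : Fin N → ℝ) :
    BddAbove (Set.range fun i => |∑ n, ε n * f i n|) := by
  obtain ⟨C, hC⟩ := hf.exists_abs_dot_le ε
  exact ⟨C, by rintro _ ⟨i, rfl⟩; exact hC i⟩

theorem iSup_add_iSup_le_of_contraction {ι : Type*} [Nonempty ι] (u a b : ι → ℝ)
    (hab : ∀ i j, |a i - a j| ≤ |b i - b j|)
    (h1 : BddAbove (Set.range fun i => u i + b i)) (h2 : BddAbove (Set.range fun i => u i - b i)) :
    (⨆ i, (u i + a i)) + (⨆ i, (u i - a i)) ≤ (⨆ i, (u i + b i)) + ⨆ i, (u i - b i) := by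
  have key : ∀ i j, (u i + a i) + (u j - a j) ≤ (⨆ i, (u i + b i)) + ⨆ i, (u i - b i) := by
    intro i j
    have e1 := le_ciSup h1 i
    have e2 := le_ciSup h1 j
    have e3 := le_ciSup h2 i
    have e4 := le_ciSup h2 j
    have e5 := (le_abs_self _).trans (hab i j)
    rcases abs_cases (b i - b j) with h | h <;> linarith
  have : ∀ j, (⨆ i, (u i + a i)) ≤ (⨆ i, (u i + b i)) + (⨆ i, (u i - b i)) - (u j - a j) :=
    fun j => ciSup_le fun i => by linarith [key i j]
  have : (⨆ j, (u j - a j)) ≤ (⨆ i, (u i + b i)) + (⨆ i, (u i - b i)) - ⨆ i, (u i + a i) :=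
    ciSup_le fun j => by linarith [this j]
  linarith

/-- Contraction in a single coordinate. -/
theorem tExp_iSup_le_of_contraction_coord {N : ℕ} {p : ℝ} (hp0 : 0 ≤ p) (hp : p ≤ 1 / 2)
    {ι : Type*} [Nonempty ι] {f g : ι → Fin N → ℝ} (hg : UniformlyBounded g) (m : Fin N)
    (hne : ∀ i n, n ≠ m → f i n = g i n) (hm : ∀ i j, |f i m - f j m| ≤ |g i m - g j m|) :
    tExp N p (fun ε => ⨆ i, ∑ n, ε n * f i n) ≤ tExp N p (fun ε => ⨆ i, ∑ n, ε n * g i n) := by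
  suffices h : tExp N p (fun ε => ⨆ i, ∑ n, ε n * f i n) +
      tExp N p (fun ε => ⨆ i, ∑ n, ε n * f i n) ≤
      tExp N p (fun ε => ⨆ i, ∑ n, ε n * g i n) + tExp N p (fun ε => ⨆ i, ∑ n, ε n * g i n) by
    linarith
  nth_rewrite 2 [← tExp_flip {m}]
  nth_rewrite 4 [← tExp_flip {m}]
  rw [← tExp_add, ← tExp_add]
  refine tExp_mono hp0 hp fun ε => ?_
  let u : ι → ℝ := fun i => ∑ n ∈ univ.erase m, ε n * g i n
  have plus : ∀ k : ι → Fin N → ℝ, (∀ i n, n ≠ m → k i n = g i n) → ∀ i,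
      ∑ n, ε n * k i n = u i + ε m * k i m := by
    intro k hk i
    rw [← Finset.add_sum_erase _ _ (Finset.mem_univ m), add_comm]
    congr 1
    exact Finset.sum_congr rfl fun n hn => by rw [hk i n (Finset.ne_of_mem_erase hn)]
  have minus : ∀ k : ι → Fin N → ℝ, (∀ i n, n ≠ m → k i n = g i n) → ∀ i,
      ∑ n, (if n ∈ ({m} : Finset (Fin N)) then -ε n else ε n) * k i n = u i - ε m * k i m := by
    intro k hk i
    rw [← Finset.add_sum_erase _ _ (Finset.mem_univ m), add_comm, sub_eq_add_neg]
    congr 1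
    · refine Finset.sum_congr rfl fun n hn => ?_
      have hn' := Finset.ne_of_mem_erase hn
      rw [hk i n hn', if_neg (by simpa using hn')]
    · simp
  have b1 := hg.bddAbove_dot ε
  have b2 := hg.bddAbove_dot fun n => if n ∈ ({m} : Finset (Fin N)) then -ε n else ε n
  simp only [plus f hne, minus f hne, plus g fun _ _ _ => rfl, minus g fun _ _ _ => rfl] at b1 b2 ⊢
  refine iSup_add_iSup_le_of_contraction u _ _ (fun i j => ?_) b1 b2
  rw [← mul_sub, ← mul_sub, abs_mul, abs_mul]
  exact mul_le_mul_of_nonneg_left (hm i j) (abs_nonneg _)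

theorem abs_map_sub_le {σ : ℝ → ℝ} (hσ : LipschitzWith 1 σ) (x y : ℝ) :
    |σ x - σ y| ≤ |x - y| := by
  simpa [Real.dist_eq] using hσ.dist_le_mul x y

theorem abs_map_le {σ : ℝ → ℝ} (hσ : LipschitzWith 1 σ) (hσ0 : σ 0 = 0) (x : ℝ) :
    |σ x| ≤ |x| := by
  simpa [hσ0] using abs_map_sub_le hσ x 0

/-- The contraction principle for suprema of linear forms. -/
theorem tExp_iSup_comp_le {N : ℕ} {p : ℝ} (hp0 : 0 ≤ p) (hp : p ≤ 1 / 2)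
    {σ : ℝ → ℝ} (hσ : LipschitzWith 1 σ) (hσ0 : σ 0 = 0)
    {ι : Type*} [Nonempty ι] {f : ι → Fin N → ℝ} (hf : UniformlyBounded f) :
    tExp N p (fun ε => ⨆ i, ∑ n, ε n * σ (f i n)) ≤ tExp N p (fun ε => ⨆ i, ∑ n, ε n * f i n) := by
  have key : ∀ A : Finset (Fin N),
      tExp N p (fun ε => ⨆ i, ∑ n, ε n * (if n ∈ A then σ (f i n) else f i n))
        ≤ tExp N p (fun ε => ⨆ i, ∑ n, ε n * f i n) := by
    intro A
    induction A using Finset.induction_on with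
    | empty => simp
    | insert m A hm ih =>
      refine le_trans ?_ ih
      refine tExp_iSup_le_of_contraction_coord hp0 hp
        (f := fun i n => if n ∈ insert m A then σ (f i n) else f i n)
        (g := fun i n => if n ∈ A then σ (f i n) else f i n) ?_ m ?_ ?_
      · obtain ⟨C, hC⟩ := hf
        refine ⟨C, fun i n => ?_⟩
        dsimp only
        split_ifs
        · exact (abs_map_le hσ hσ0 _).trans (hC i n)
        · exact hC i n
      · intro i n hn
        simp [hn]
      · intro i j
        simpa [hm] using abs_map_sub_le hσ (f i m) (f j m)
  simpa using key univ

/-- The contraction principle for suprema of absolute values of linear forms. -/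
theorem tExp_iSup_abs_comp_le {N : ℕ} {p : ℝ} (hp0 : 0 ≤ p) (hp : p ≤ 1 / 2)
    {σ : ℝ → ℝ} (hσ : LipschitzWith 1 σ) (hσ0 : σ 0 = 0)
    {ι : Type*} [Nonempty ι] {f : ι → Fin N → ℝ} (hf : UniformlyBounded f) :
    tExp N p (fun ε => ⨆ i, |∑ n, ε n * σ (f i n)|)
      ≤ 2 * tExp N p (fun ε => ⨆ i, |∑ n, ε n * f i n|) := by
  let g : Option ι → Fin N → ℝ := fun o n => o.elim 0 fun i => f i n
  have hg : UniformlyBounded g := by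
    obtain ⟨C, hC⟩ := hf
    refine ⟨max C 0, fun o n => ?_⟩
    cases o with
    | none => simp [g]
    | some i => exact (hC i n).trans (le_max_left _ _)
  have hσg : UniformlyBounded fun o n => σ (g o n) := by
    obtain ⟨C, hC⟩ := hg
    exact ⟨C, fun o n => (abs_map_le hσ hσ0 _).trans (hC o n)⟩
  have h1 : tExp N p (fun ε => ⨆ i, |∑ n, ε n * σ (f i n)|) ≤
      tExp N p (fun ε => (⨆ o, ∑ n, ε n * σ (g o n)) +
        ⨆ o, ∑ n, (if n ∈ (univ : Finset (Fin N)) then -ε n else ε n) * σ (g o n)) := by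
    refine tExp_mono hp0 hp fun ε => ciSup_le fun i => ?_
    have b1 := hσg.bddAbove_dot ε
    have b2 := hσg.bddAbove_dot fun n => if n ∈ (univ : Finset (Fin N)) then -ε n else ε n
    have e1 := le_ciSup b1 none
    have e2 := le_ciSup b2 none
    have e3 := le_ciSup b1 (some i)
    have e4 := le_ciSup b2 (some i)
    simp only [g, Option.elim, hσ0, mul_zero, Finset.sum_const_zero, Finset.mem_univ, if_true,
      neg_mul, Finset.sum_neg_distrib] at e1 e2 e3 e4 ⊢
    rcases abs_cases (∑ n, ε n * σ (f i n)) with h | h <;> linarith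
  rw [tExp_add, tExp_flip univ fun ε => ⨆ o, ∑ n, ε n * σ (g o n)] at h1
  have h2 := tExp_iSup_comp_le hp0 hp hσ hσ0 hg
  have h3 : tExp N p (fun ε => ⨆ o, ∑ n, ε n * g o n)
      ≤ tExp N p (fun ε => ⨆ i, |∑ n, ε n * f i n|) := by
    refine tExp_mono hp0 hp fun ε => ciSup_le fun o => ?_
    cases o with
    | none =>
      simpa [g] using Real.iSup_nonneg fun i => abs_nonneg (∑ n, ε n * f i n)
    | some i => exact (le_abs_self _).trans (le_ciSup (hf.bddAbove_abs_dot ε) i)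
  linarith

/-- Weights and an output column of an MLP with `t + 1` layers whose weight columns
are bounded in `ℓ1`-norm by `B`. -/
def AdmissibleWeights (q h : ℕ) (B : ℕ → ℝ) (t : ℕ) : Type :=
  {w : Matrix (Fin q) (Fin h) ℝ × (ℕ → Matrix (Fin h) (Fin h) ℝ) × Fin h //
    (∀ cc, ∑ r, |w.1 r cc| ≤ B 0) ∧ ∀ l < t, ∀ cc, ∑ r, |w.2.1 l r cc| ≤ B (l + 1)}

theorem AdmissibleWeights.nonempty {q h : ℕ} (hh : 0 < h) {B : ℕ → ℝ} {t : ℕ}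
    (hB : ∀ l ≤ t, 0 ≤ B l) : Nonempty (AdmissibleWeights q h B t) :=
  ⟨⟨(0, 0, ⟨0, hh⟩), fun _ => by simpa using hB 0 (Nat.zero_le _),
    fun l hl _ => by simpa using hB (l + 1) hl⟩⟩

/-- The column of the MLP output selected by `w`. -/
noncomputable def AdmissibleWeights.output {N q h : ℕ} {B : ℕ → ℝ} {t : ℕ} (σ : ℝ → ℝ)
    (X : Matrix (Fin N) (Fin q) ℝ) (w : AdmissibleWeights q h B t) (n : Fin N) : ℝ :=
  mlp σ X w.1.1 w.1.2.1 t n w.1.2.2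

theorem abs_sum_mul_le {κ : Type*} [Fintype κ] {x w : κ → ℝ} {b C : ℝ} (hC : 0 ≤ C)
    (hx : ∀ r, |x r| ≤ C) (hw : ∑ r, |w r| ≤ b) : |∑ r, x r * w r| ≤ b * C :=
  calc |∑ r, x r * w r| ≤ ∑ r, |w r| * C := by
        refine (Finset.abs_sum_le_sum_abs _ _).trans (Finset.sum_le_sum fun r _ => ?_)
        rw [abs_mul, mul_comm]
        exact mul_le_mul_of_nonneg_left (hx r) (abs_nonneg _)
    _ = (∑ r, |w r|) * C := (Finset.sum_mul ..).symm
    _ ≤ b * C := mul_le_mul_of_nonneg_right hw hC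

theorem sum_mul_sum_mul_comm {N : ℕ} {κ : Type*} [Fintype κ] (ε : Fin N → ℝ)
    (x : Fin N → κ → ℝ) (w : κ → ℝ) :
    ∑ n, ε n * ∑ r, x n r * w r = ∑ r, (∑ n, ε n * x n r) * w r := by
  simp only [Finset.mul_sum, Finset.sum_mul]
  rw [Finset.sum_comm]
  exact Finset.sum_congr rfl fun r _ => Finset.sum_congr rfl fun n _ => by ring

theorem exists_abs_entry_le {N q : ℕ} (X : Matrix (Fin N) (Fin q) ℝ) :
    ∃ C, 0 ≤ C ∧ ∀ n r, |X n r| ≤ C := by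
  refine ⟨∑ n, ∑ r, |X n r|, by positivity, fun n r => ?_⟩
  exact (Finset.single_le_sum (f := fun r => |X n r|) (fun _ _ => abs_nonneg _)
    (Finset.mem_univ r)).trans (Finset.single_le_sum (f := fun n => ∑ r, |X n r|)
      (fun _ _ => by positivity) (Finset.mem_univ n))

/-- The first-layer preactivations are uniformly bounded. -/
theorem uniformlyBounded_mul {N q h : ℕ} {B : ℕ → ℝ} (X : Matrix (Fin N) (Fin q) ℝ) (t : ℕ) :
    UniformlyBounded fun (w : AdmissibleWeights q h B t) n => ∑ r, X n r * w.1.1 r w.1.2.2 := by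
  obtain ⟨C, hC0, hC⟩ := exists_abs_entry_le X
  exact ⟨B 0 * C, fun w n => abs_sum_mul_le hC0 (hC n) (w.2.1 _)⟩

/-- Admissible weights for one layer fewer, reading column `r` of the previous layer. -/
def AdmissibleWeights.pred {q h : ℕ} {B : ℕ → ℝ} {t : ℕ} (w : AdmissibleWeights q h B (t + 1))
    (r : Fin h) : AdmissibleWeights q h B t :=
  ⟨(w.1.1, w.1.2.1, r), w.2.1, fun l hl => w.2.2 l (hl.trans t.lt_succ_self)⟩

theorem AdmissibleWeights.output_zero {N q h : ℕ} {B : ℕ → ℝ} (σ : ℝ → ℝ)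
    (X : Matrix (Fin N) (Fin q) ℝ) (w : AdmissibleWeights q h B 0) (n : Fin N) :
    w.output σ X n = σ (∑ r, X n r * w.1.1 r w.1.2.2) := rfl

theorem AdmissibleWeights.output_succ {N q h : ℕ} {B : ℕ → ℝ} {t : ℕ} (σ : ℝ → ℝ)
    (X : Matrix (Fin N) (Fin q) ℝ) (w : AdmissibleWeights q h B (t + 1)) (n : Fin N) :
    w.output σ X n = σ (∑ r, (w.pred r).output σ X n * w.1.2.1 t r w.1.2.2) := rfl

theorem UniformlyBounded.preactivation {N q h : ℕ} {B : ℕ → ℝ} {t : ℕ} {σ : ℝ → ℝ}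
    {X : Matrix (Fin N) (Fin q) ℝ}
    (hb : UniformlyBounded fun w : AdmissibleWeights q h B t => w.output σ X) :
    UniformlyBounded fun (w : AdmissibleWeights q h B (t + 1)) n =>
      ∑ r, (w.pred r).output σ X n * w.1.2.1 t r w.1.2.2 := by
  obtain ⟨C, hC⟩ := hb
  exact ⟨B (t + 1) * max C 0, fun w n => abs_sum_mul_le (le_max_right _ _)
    (fun r => (hC (w.pred r) n).trans (le_max_left _ _)) (w.2.2 t t.lt_succ_self _)⟩

theorem AdmissibleWeights.uniformlyBounded_output {N q h : ℕ} {B : ℕ → ℝ} {σ : ℝ → ℝ}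
    (hσ : LipschitzWith 1 σ) (hσ0 : σ 0 = 0) (X : Matrix (Fin N) (Fin q) ℝ) (t : ℕ) :
    UniformlyBounded fun w : AdmissibleWeights q h B t => w.output σ X := by
  induction t with
  | zero =>
    obtain ⟨C, hC⟩ := uniformlyBounded_mul (h := h) (B := B) X 0
    exact ⟨C, fun w n => (abs_map_le hσ hσ0 _).trans (hC w n)⟩
  | succ t ih =>
    obtain ⟨C, hC⟩ := ih.preactivation
    exact ⟨C, fun w n => (abs_map_le hσ hσ0 _).trans (hC w n)⟩

theorem tExp_sqrt_sum_dot_sq_le {N q : ℕ} {p : ℝ} (hp0 : 0 ≤ p) (hp : p ≤ 1 / 2)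
    (X : Matrix (Fin N) (Fin q) ℝ) :
    tExp N p (fun ε => √(∑ r, (∑ n, ε n * X n r) ^ 2)) ≤ √(2 * p) * frob X := by
  refine (tExp_sqrt_le hp0 hp fun ε => by positivity).trans_eq ?_
  rw [tExp_sum, frob, ← Real.sqrt_mul (by positivity)]
  congr 1
  simp only [tExp_dot_sq]
  rw [← Finset.mul_sum, Finset.sum_comm]

/-- Layer peeling: the complexity of an MLP with `t + 1` layers. -/
theorem tExp_iSup_abs_output_le {N q h : ℕ} (hh : 0 < h) {p : ℝ} (hp0 : 0 ≤ p) (hp : p ≤ 1 / 2)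
    (X : Matrix (Fin N) (Fin q) ℝ) {σ : ℝ → ℝ} (hσ : LipschitzWith 1 σ) (hσ0 : σ 0 = 0)
    {B : ℕ → ℝ} (t : ℕ) (hB : ∀ l ≤ t, 0 ≤ B l) :
    tExp N p (fun ε => ⨆ w : AdmissibleWeights q h B t, |∑ n, ε n * w.output σ X n|)
      ≤ 2 ^ (t + 1) * (∏ l ∈ range (t + 1), B l) * √(2 * p) * frob X := by
  induction t with
  | zero =>
    have := AdmissibleWeights.nonempty (q := q) hh hB
    refine (tExp_iSup_abs_comp_le hp0 hp hσ hσ0 (uniformlyBounded_mul X 0)).trans ?_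
    have h1 : tExp N p (fun ε => ⨆ w : AdmissibleWeights q h B 0,
        |∑ n, ε n * ∑ r, X n r * w.1.1 r w.1.2.2|)
        ≤ tExp N p (fun ε => B 0 * √(∑ r, (∑ n, ε n * X n r) ^ 2)) := by
      refine tExp_mono hp0 hp fun ε => ciSup_le fun w => ?_
      rw [sum_mul_sum_mul_comm ε (fun n r => X n r) fun r => w.1.1 r w.1.2.2]
      refine abs_sum_mul_le (Real.sqrt_nonneg _) (fun r => Real.abs_le_sqrt ?_) (w.2.1 _)
      exact Finset.single_le_sum (f := fun r => (∑ n, ε n * X n r) ^ 2)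
        (fun _ _ => sq_nonneg _) (Finset.mem_univ r)
    rw [tExp_const_mul] at h1
    have h2 := mul_le_mul_of_nonneg_left (tExp_sqrt_sum_dot_sq_le hp0 hp X) (hB 0 le_rfl)
    simp only [zero_add, pow_one, Finset.prod_range_one]
    linarith
  | succ t ih =>
    have := AdmissibleWeights.nonempty (q := q) hh hB
    have hb := AdmissibleWeights.uniformlyBounded_output (h := h) (B := B) hσ hσ0 X t
    refine (tExp_iSup_abs_comp_le hp0 hp hσ hσ0 hb.preactivation).trans ?_
    have h1 : tExp N p (fun ε => ⨆ w : AdmissibleWeights q h B (t + 1),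
        |∑ n, ε n * ∑ r, (w.pred r).output σ X n * w.1.2.1 t r w.1.2.2|)
        ≤ tExp N p (fun ε => B (t + 1) *
          ⨆ w : AdmissibleWeights q h B t, |∑ n, ε n * w.output σ X n|) := by
      refine tExp_mono hp0 hp fun ε => ciSup_le fun w => ?_
      rw [sum_mul_sum_mul_comm]
      exact abs_sum_mul_le (Real.iSup_nonneg fun _ => abs_nonneg _)
        (fun r => le_ciSup (hb.bddAbove_abs_dot ε) (w.pred r)) (w.2.2 t t.lt_succ_self _)
    rw [tExp_const_mul] at h1
    have h2 := mul_le_mul_of_nonneg_left (ih fun l hl => hB l (hl.trans t.le_succ))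
      (hB (t + 1) le_rfl)
    rw [Finset.prod_range_succ, pow_succ]
    linarith

/-- Bound on the symmetric transductive Rademacher complexity of the `T`-layer
MLP feature-extraction part of the GPCN models, by iterated contraction and
ℓ1 layer peeling. -/
theorem rademacher_mlp_bound
    (N q h T : ℕ) (hN : 0 < N) (hq : 0 < q) (hh : 0 < h) (hT : 0 < T)
    (p : ℝ) (hp0 : 0 ≤ p) (hp : p ≤ 1 / 2)
    (X : Matrix (Fin N) (Fin q) ℝ)
    (σ : ℝ → ℝ) (hσ : LipschitzWith 1 σ) (hσ0 : σ 0 = 0)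
    (B : ℕ → ℝ) (hB : ∀ l ≤ T - 1, 0 ≤ B l) :
    tExp N p (fun ε =>
        sSup {y : ℝ | ∃ (W0 : Matrix (Fin q) (Fin h) ℝ)
            (Ws : ℕ → Matrix (Fin h) (Fin h) ℝ) (c : Fin h),
          (∀ cc, ∑ r, |W0 r cc| ≤ B 0) ∧
          (∀ l, l < T - 1 → ∀ cc, ∑ r, |Ws l r cc| ≤ B (l + 1)) ∧
          y = |∑ n, ε n * mlp σ X W0 Ws (T - 1) n c|})
      ≤ (2 : ℝ) ^ T * (∏ l ∈ Finset.range T, B l) * Real.sqrt (2 * p) *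
          frob X := by
  obtain ⟨t, rfl⟩ := Nat.exists_eq_add_of_lt hT
  simp only [zero_add, Nat.add_sub_cancel] at hB ⊢
  refine le_trans (le_of_eq ?_) (tExp_iSup_abs_output_le hh hp0 hp X hσ hσ0 t hB)
  congr 1
  funext ε
  refine congrArg sSup (Set.ext fun y => ⟨?_, ?_⟩)
  · rintro ⟨W0, Ws, c, h0, hs, rfl⟩
    exact ⟨⟨(W0, Ws, c), h0, hs⟩, rfl⟩
  · rintro ⟨w, rfl⟩
    exact ⟨w.1.1, w.1.2.1, w.1.2.2, w.2.1, w.2.2, rfl⟩
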